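/- Let C be a 2-copula and m ≥ 1, and define the linear B-spline approximation C_LB(u,v) = ∑_{i=0}^{m} ∑_{j=0}^{m} C(i/m, j/m) N_i(u) N_j(v) for (u,v) ∈ [0,1] × [0,1]. Then C_LB is a 2-copula. -/

import Mathlib

open Set

/-- A 2-copula on `[0,1]²`. -/
def IsCopula (C : ℝ → ℝ → ℝ) : Prop :=
  (∀ u ∈ Icc (0:ℝ) 1, C u 0 = 0) ∧ (∀ v ∈ Icc (0:ℝ) 1, C 0 v = 0) ∧
  (∀ u ∈ Icc (0:ℝ) 1, C u 1 = u) ∧ (∀ v ∈ Icc (0:ℝ) 1, C 1 v = v) ∧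
  (∀ u₁ u₂ v₁ v₂ : ℝ, u₁ ∈ Icc (0:ℝ) 1 → u₂ ∈ Icc (0:ℝ) 1 → v₁ ∈ Icc (0:ℝ) 1 →
    v₂ ∈ Icc (0:ℝ) 1 → u₁ ≤ u₂ → v₁ ≤ v₂ →
    0 ≤ C u₂ v₂ - C u₂ v₁ - C u₁ v₂ + C u₁ v₁)

/-- The linear B-spline basis functions on `[0,1]` with knots `i/m`. -/
noncomputable def N (m i : ℕ) (u : ℝ) : ℝ :=
  if i = 0 then
    (if 0 ≤ u ∧ u < 1 / (m : ℝ) then 1 - m * u else 0)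
  else if i = m then
    (if ((m : ℝ) - 1) / m ≤ u ∧ u ≤ 1 then m * u - ((m : ℝ) - 1) else 0)
  else if ((i : ℝ) - 1) / m ≤ u ∧ u < (i : ℝ) / m then m * u - ((i : ℝ) - 1)
  else if (i : ℝ) / m ≤ u ∧ u < ((i : ℝ) + 1) / m then ((i : ℝ) + 1) - m * u
  else 0

/-- Clamped ramp, whose successive differences are the B-splines. -/
noncomputable def ramp (m i : ℕ) (u : ℝ) : ℝ := max 0 (min 1 (m * u - i + 1))

lemma ramp_mono (m i : ℕ) {u v : ℝ} (h : u ≤ v) : ramp m i u ≤ ramp m i v := by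
  unfold ramp
  gcongr

lemma ramp_zero (m : ℕ) {u : ℝ} (h : 0 ≤ u) : ramp m 0 u = 1 := by
  unfold ramp
  have : 0 ≤ (m:ℝ) * u := by positivity
  rw [min_eq_left (by push_cast; linarith)]
  norm_num

lemma ramp_last (m : ℕ) {u : ℝ} (h : u ≤ 1) : ramp m (m+1) u = 0 := by
  unfold ramp
  have : (m:ℝ) * u ≤ m := mul_le_of_le_one_right (by positivity) h
  apply max_eq_left
  apply (min_le_right _ _).trans
  push_cast; linarith

lemma N_eq_ramp (m i : ℕ) (hm : 1 ≤ m) (hi : i ≤ m) {u : ℝ} (hu : u ∈ Icc (0:ℝ) 1) :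
    N m i u = ramp m i u - ramp m (i+1) u := by
  obtain ⟨h0, h1⟩ := hu
  have hm0 : (0:ℝ) < m := by exact_mod_cast hm
  have hx0 : 0 ≤ (m:ℝ) * u := by positivity
  have hx1 : (m:ℝ) * u ≤ m := mul_le_of_le_one_right (by positivity) h1
  unfold N
  simp only [div_le_iff₀ hm0, lt_div_iff₀ hm0, mul_comm u (m:ℝ)]
  split_ifs with a b c d e f
  · subst a
    rw [ramp_zero m h0, ramp, min_eq_right, max_eq_right] <;> push_cast <;> linarith
  · subst a
    have : 1 ≤ (m:ℝ) * u := by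
      by_contra h
      exact b ⟨h0, by linarith⟩
    rw [ramp_zero m h0, ramp, min_eq_left, max_eq_right] <;> push_cast <;> linarith
  · subst c
    rw [ramp_last i h1, ramp, min_eq_right, max_eq_right] <;> linarith
  · subst c
    have : (i:ℝ) * u < i - 1 := by
      by_contra h
      exact d ⟨by linarith, h1⟩
    rw [ramp_last i h1, ramp, min_eq_right, max_eq_left] <;> linarith
  · rw [ramp, ramp, min_eq_right, max_eq_right, min_eq_right, max_eq_left] <;> push_cast <;> linarith
  · rw [ramp, ramp, min_eq_left, max_eq_right, min_eq_right, max_eq_right] <;> push_cast <;> linarith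
  · rcases lt_or_ge ((m:ℝ) * u) (i - 1) with h | h
    · rw [ramp, ramp, min_eq_right, max_eq_left, min_eq_right, max_eq_left] <;> push_cast <;> linarith
    · have h2 : (i:ℝ) ≤ m * u := by
        by_contra h'
        exact e ⟨h, by linarith⟩
      have h3 : (i:ℝ) + 1 ≤ m * u := by
        by_contra h'
        exact f ⟨h2, by linarith⟩
      rw [ramp, ramp, min_eq_left, max_eq_right, min_eq_left, max_eq_right] <;> push_cast <;> linarith

lemma sum_parts (a S : ℕ → ℝ) (n : ℕ) :
    ∑ i ∈ Finset.range (n+1), a i * (S i - S (i+1)) =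
      a 0 * S 0 + ∑ i ∈ Finset.range n, (a (i+1) - a i) * S (i+1) - a n * S (n+1) := by
  induction n with
  | zero => simp; ring
  | succ n ih => rw [Finset.sum_range_succ, ih, Finset.sum_range_succ]; ring

lemma sum_N (a : ℕ → ℝ) (m : ℕ) (hm : 1 ≤ m) {u : ℝ} (hu : u ∈ Icc (0:ℝ) 1) :
    ∑ i ∈ Finset.range (m+1), a i * N m i u =
      a 0 + ∑ i ∈ Finset.range m, (a (i+1) - a i) * ramp m (i+1) u := by
  rw [Finset.sum_congr rfl (fun i hi => by
    rw [N_eq_ramp m i hm (Nat.lt_succ_iff.mp (Finset.mem_range.mp hi)) hu])]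
  rw [sum_parts a (fun i => ramp m i u), ramp_zero m hu.1, ramp_last m hu.2]
  ring

lemma sum_N_zero (a : ℕ → ℝ) (m : ℕ) (hm : 1 ≤ m) :
    ∑ i ∈ Finset.range (m+1), a i * N m i 0 = a 0 := by
  rw [sum_N a m hm (by simp), Finset.sum_eq_zero, add_zero]
  intro i _
  have : ramp m (i+1) 0 = 0 := by
    unfold ramp
    apply max_eq_left
    apply (min_le_right _ _).trans
    push_cast
    have : (0:ℝ) ≤ i := by positivity
    linarith
  rw [this, mul_zero]

lemma sum_N_one (a : ℕ → ℝ) (m : ℕ) (hm : 1 ≤ m) :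
    ∑ i ∈ Finset.range (m+1), a i * N m i 1 = a m := by
  rw [sum_N a m hm (by simp)]
  rw [Finset.sum_congr rfl (g := fun i => a (i+1) - a i), Finset.sum_range_sub]
  · ring
  intro i hi
  have : ramp m (i+1) 1 = 1 := by
    have h : ((i+1 : ℕ):ℝ) ≤ m := by exact_mod_cast Finset.mem_range.mp hi
    unfold ramp
    rw [min_eq_left (by linarith)]
    norm_num
  rw [this, mul_one]

lemma sum_ramp (m : ℕ) {u : ℝ} (hu : 0 ≤ u) (n : ℕ) :
    ∑ i ∈ Finset.range n, ramp m (i+1) u = min (m * u) n := by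
  have hx : 0 ≤ (m:ℝ) * u := by positivity
  induction n with
  | zero => simp [hx]
  | succ n ih =>
    rw [Finset.sum_range_succ, ih, ramp]
    push_cast
    rcases le_total ((m:ℝ)*u) n with h | h
    · rw [min_eq_left h, min_eq_right (by linarith), max_eq_left (by linarith),
        min_eq_left (by linarith)]; ring
    · rcases le_total ((m:ℝ)*u) (n+1) with h' | h'
      · rw [min_eq_right h, min_eq_right (by linarith), max_eq_right (by linarith),
          min_eq_left (by linarith)]; ring
      · rw [min_eq_right h, min_eq_left (by linarith), max_eq_right (by linarith),
          min_eq_right (by linarith)]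

lemma sum_N_id (m : ℕ) (hm : 1 ≤ m) {u : ℝ} (hu : u ∈ Icc (0:ℝ) 1) :
    ∑ i ∈ Finset.range (m+1), ((i:ℝ) / m) * N m i u = u := by
  have hm0 : (0:ℝ) < m := by exact_mod_cast hm
  rw [sum_N (fun i => (i:ℝ)/m) m hm hu]
  rw [Finset.sum_congr rfl (g := fun i => (1/(m:ℝ)) * ramp m (i+1) u)
    (fun i _ => by push_cast; ring), ← Finset.mul_sum, sum_ramp m hu.1,
    min_eq_left (mul_le_of_le_one_right hm0.le hu.2)]
  field_simp
  simp

/-- The linear B-spline approximation of a 2-copula is a 2-copula. -/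
theorem bspline_approximation_isCopula (C : ℝ → ℝ → ℝ) (hC : IsCopula C)
    (m : ℕ) (hm : 1 ≤ m) :
    IsCopula (fun u v => ∑ i ∈ Finset.range (m + 1), ∑ j ∈ Finset.range (m + 1),
      C ((i : ℝ) / m) ((j : ℝ) / m) * N m i u * N m j v) := by
  obtain ⟨c1, c2, c3, c4, c5⟩ := hC
  have hm0 : (0:ℝ) < m := by exact_mod_cast hm
  have knot : ∀ i : ℕ, i ≤ m → (i:ℝ)/m ∈ Icc (0:ℝ) 1 := fun i hi =>
    ⟨by positivity, by rw [div_le_one hm0]; exact_mod_cast hi⟩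
  have knot' : ∀ i ∈ Finset.range (m+1), (i:ℝ)/m ∈ Icc (0:ℝ) 1 := fun i hi =>
    knot i (Nat.lt_succ_iff.mp (Finset.mem_range.mp hi))
  have e1 : ∀ u v, ∑ i ∈ Finset.range (m + 1), ∑ j ∈ Finset.range (m + 1),
      C ((i : ℝ) / m) ((j : ℝ) / m) * N m i u * N m j v =
      ∑ i ∈ Finset.range (m + 1), (∑ j ∈ Finset.range (m + 1),
      C ((i : ℝ) / m) ((j : ℝ) / m) * N m j v) * N m i u := by
    intro u v
    refine Finset.sum_congr rfl fun i _ => ?_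
    rw [Finset.sum_mul]
    exact Finset.sum_congr rfl fun j _ => by ring
  simp only [e1]
  have hmm : (m:ℝ)/m = 1 := div_self hm0.ne'
  refine ⟨?_, ?_, ?_, ?_, ?_⟩
  · intro u hu
    refine Finset.sum_eq_zero fun i hi => ?_
    rw [sum_N_zero (fun j => C ((i:ℝ)/m) ((j:ℝ)/m)) m hm]
    simp [c1 _ (knot' i hi)]
  · intro v hv
    beta_reduce
    rw [sum_N_zero (fun i => ∑ j ∈ Finset.range (m + 1), C ((i : ℝ) / m) ((j : ℝ) / m) * N m j v) m hm]
    refine Finset.sum_eq_zero fun j hj => ?_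
    simp [c2 _ (knot' j hj)]
  · intro u hu
    refine Eq.trans (Finset.sum_congr rfl fun i hi => ?_) (sum_N_id m hm hu)
    rw [sum_N_one (fun j => C ((i:ℝ)/m) ((j:ℝ)/m)) m hm, hmm, c3 _ (knot' i hi)]
  · intro v hv
    beta_reduce
    rw [sum_N_one (fun i => ∑ j ∈ Finset.range (m + 1), C ((i : ℝ) / m) ((j : ℝ) / m) * N m j v) m hm]
    refine Eq.trans (Finset.sum_congr rfl fun j hj => ?_) (sum_N_id m hm hv)
    rw [hmm, c4 _ (knot' j hj)]
  · intro u₁ u₂ v₁ v₂ hu₁ hu₂ hv₁ hv₂ hu hv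
    beta_reduce
    have e2 : ∀ v, ∀ u ∈ Icc (0:ℝ) 1, ∑ i ∈ Finset.range (m + 1), (∑ j ∈ Finset.range (m + 1),
      C ((i : ℝ) / m) ((j : ℝ) / m) * N m j v) * N m i u = _ := fun v u hu => 
      sum_N (fun i => ∑ j ∈ Finset.range (m + 1), C ((i : ℝ) / m) ((j : ℝ) / m) * N m j v) m hm hu
    rw [e2 _ _ hu₁, e2 _ _ hu₁, e2 _ _ hu₂, e2 _ _ hu₂]
    have e3 : ∀ i : ℕ, ∀ v ∈ Icc (0:ℝ) 1, ∑ j ∈ Finset.range (m + 1),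
      C ((i : ℝ) / m) ((j : ℝ) / m) * N m j v = _ := fun i v hv =>
      sum_N (fun j => C ((i : ℝ) / m) ((j : ℝ) / m)) m hm hv
    simp only [e3 _ _ hv₁, e3 _ _ hv₂]
    have key : 0 ≤ ∑ i ∈ Finset.range m, ∑ j ∈ Finset.range m,
        (C (((i+1:ℕ):ℝ)/m) (((j+1:ℕ):ℝ)/m) - C (((i+1:ℕ):ℝ)/m) ((j:ℝ)/m)
          - C ((i:ℝ)/m) (((j+1:ℕ):ℝ)/m) + C ((i:ℝ)/m) ((j:ℝ)/m)) *
        (ramp m (j+1) v₂ - ramp m (j+1) v₁) * (ramp m (i+1) u₂ - ramp m (i+1) u₁) := by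
      refine Finset.sum_nonneg fun i hi => Finset.sum_nonneg fun j hj => ?_
      have hi' := Finset.mem_range.mp hi
      have hj' := Finset.mem_range.mp hj
      refine mul_nonneg (mul_nonneg ?_ (sub_nonneg.2 (ramp_mono _ _ hv)))
        (sub_nonneg.2 (ramp_mono _ _ hu))
      apply c5 _ _ _ _ (knot i hi'.le) (knot (i+1) hi') (knot j hj'.le) (knot (j+1) hj')
      · gcongr; omega
      · gcongr; omega
    refine key.trans_eq ?_
    rw [← sub_eq_zero]
    have e5 : ∀ (p q : ℝ) (f1 f2 f3 f4 : ℕ → ℝ),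
        (p + ∑ i ∈ Finset.range m, f1 i) - (q + ∑ i ∈ Finset.range m, f2 i)
        - (p + ∑ i ∈ Finset.range m, f3 i) + (q + ∑ i ∈ Finset.range m, f4 i)
        = ∑ i ∈ Finset.range m, (f1 i - f2 i - f3 i + f4 i) := by
      intro p q f1 f2 f3 f4
      simp only [Finset.sum_add_distrib, Finset.sum_sub_distrib]
      ring
    rw [e5, sub_eq_zero]
    refine Finset.sum_congr rfl fun i _ => ?_
    rw [← Finset.sum_mul]
    have e6 : ∀ j : ℕ, (C (((i+1:ℕ):ℝ)/m) (((j+1:ℕ):ℝ)/m) - C (((i+1:ℕ):ℝ)/m) ((j:ℝ)/m)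
          - C ((i:ℝ)/m) (((j+1:ℕ):ℝ)/m) + C ((i:ℝ)/m) ((j:ℝ)/m)) *
        (ramp m (j+1) v₂ - ramp m (j+1) v₁) =
        (C (((i+1:ℕ):ℝ)/m) (((j+1:ℕ):ℝ)/m) - C (((i+1:ℕ):ℝ)/m) ((j:ℝ)/m)) * ramp m (j+1) v₂
        - (C (((i+1:ℕ):ℝ)/m) (((j+1:ℕ):ℝ)/m) - C (((i+1:ℕ):ℝ)/m) ((j:ℝ)/m)) * ramp m (j+1) v₁
        - (C ((i:ℝ)/m) (((j+1:ℕ):ℝ)/m) - C ((i:ℝ)/m) ((j:ℝ)/m)) * ramp m (j+1) v₂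
        + (C ((i:ℝ)/m) (((j+1:ℕ):ℝ)/m) - C ((i:ℝ)/m) ((j:ℝ)/m)) * ramp m (j+1) v₁ := by
      intro j; ring
    rw [Finset.sum_congr rfl fun j _ => e6 j, Finset.sum_add_distrib, Finset.sum_sub_distrib,
      Finset.sum_sub_distrib]
    ring
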